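/- Let U′, U″, V be unitary matrices of sizes n′×n′, n″×n″, p×p with n′ ≥ p, n″ ≥ p and 2p < n′ + n″, written in the block forms described below, and assume Condition A: 1 is not an eigenvalue of V·U′₂₂·V⁻¹·U″₁₁. Then the generalized star product U = U′ *_V U″ is a unitary (n′ + n″ − 2p)×(n′ + n″ − 2p) matrix. -/

import Mathlib

open Matrix

noncomputable section

/-- Condition A for the generalized star product: `1` is not an eigenvalue of
`V·U′₂₂·V⁻¹·U″₁₁`. -/
def CondA {α β γ : Type*} [Fintype α] [Fintype β] [Fintype γ] [DecidableEq γ]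
    (U' : Matrix (α ⊕ γ) (α ⊕ γ) ℂ) (U'' : Matrix (γ ⊕ β) (γ ⊕ β) ℂ)
    (V : Matrix γ γ ℂ) : Prop :=
  ¬ Module.End.HasEigenvalue
      (Matrix.mulVecLin (V * U'.toBlocks₂₂ * V⁻¹ * U''.toBlocks₁₁)) 1

/-- The generalized star product `U = U′ *_V U″`: the last `p` channels of `U′` are
glued to the first `p` channels of `U″` through the unitary `V`. -/
noncomputable def starProd {α β γ : Type*} [Fintype α] [Fintype β] [Fintype γ]
    [DecidableEq γ]
    (U' : Matrix (α ⊕ γ) (α ⊕ γ) ℂ) (U'' : Matrix (γ ⊕ β) (γ ⊕ β) ℂ)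
    (V : Matrix γ γ ℂ) : Matrix (α ⊕ β) (α ⊕ β) ℂ :=
  let K₁ : Matrix γ γ ℂ := (1 - V * U'.toBlocks₂₂ * V⁻¹ * U''.toBlocks₁₁)⁻¹ * V
  let K₂ : Matrix γ γ ℂ := (1 - V⁻¹ * U''.toBlocks₁₁ * V * U'.toBlocks₂₂)⁻¹ * V⁻¹
  Matrix.fromBlocks
    (U'.toBlocks₁₁ + U'.toBlocks₁₂ * K₂ * U''.toBlocks₁₁ * V * U'.toBlocks₂₁)
    (U'.toBlocks₁₂ * K₂ * U''.toBlocks₁₂)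
    (U''.toBlocks₂₁ * K₁ * U'.toBlocks₂₁)
    (U''.toBlocks₂₂ + U''.toBlocks₂₁ * K₁ * U'.toBlocks₂₂ * V⁻¹ * U''.toBlocks₁₂)

theorem CondA.isUnit_det {α β γ : Type*} [Fintype α] [Fintype β] [Fintype γ] [DecidableEq γ]
    {U' : Matrix (α ⊕ γ) (α ⊕ γ) ℂ} {U'' : Matrix (γ ⊕ β) (γ ⊕ β) ℂ} {V : Matrix γ γ ℂ}
    (hA : CondA U' U'' V) :
    IsUnit (1 - V * U'.toBlocks₂₂ * V⁻¹ * U''.toBlocks₁₁).det := by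
  rw [isUnit_iff_ne_zero]
  intro h
  obtain ⟨v, hv, h0⟩ := Matrix.exists_mulVec_eq_zero_iff.mpr h
  refine hA (Module.End.hasEigenvalue_of_hasEigenvector (x := v) ?_)
  rw [Module.End.hasEigenvector_iff, Module.End.mem_eigenspace_iff]
  refine ⟨?_, hv⟩
  rw [Matrix.sub_mulVec, Matrix.one_mulVec, sub_eq_zero] at h0
  rw [Matrix.mulVecLin_apply, one_smul]
  exact h0.symm

/-- The output of the star product is obtained by solving for the internal amplitudes `X`, `Y`
in the glued channels. -/
theorem exists_starProd_mul_fromRows {α β γ δ : Type*} [Fintype α] [Fintype β] [Fintype γ]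
    [DecidableEq γ] {U' : Matrix (α ⊕ γ) (α ⊕ γ) ℂ} {U'' : Matrix (γ ⊕ β) (γ ⊕ β) ℂ}
    {V : Matrix γ γ ℂ} (hV : IsUnit V.det) (hA : CondA U' U'' V)
    (A : Matrix α δ ℂ) (B : Matrix β δ ℂ) :
    ∃ (A' : Matrix α δ ℂ) (B' : Matrix β δ ℂ) (X Y : Matrix γ δ ℂ),
      starProd U' U'' V * fromRows A B = fromRows A' B' ∧
      U' * fromRows A Y = fromRows A' X ∧
      U'' * fromRows (V * X) B = fromRows (V * Y) B' := by
  have hP := hA.isUnit_det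
  have hQ : IsUnit (1 - V⁻¹ * U''.toBlocks₁₁ * V * U'.toBlocks₂₂).det := by
    rwa [Matrix.mul_assoc (V⁻¹ * _), Matrix.det_one_sub_mul_comm, ← Matrix.mul_assoc]
  unfold starProd
  rw [← fromBlocks_toBlocks U', ← fromBlocks_toBlocks U'']
  simp only [toBlocks_fromBlocks₁₁, toBlocks_fromBlocks₁₂, toBlocks_fromBlocks₂₁,
    toBlocks_fromBlocks₂₂]
  generalize U'.toBlocks₁₁ = a at *
  generalize U'.toBlocks₁₂ = b at *
  generalize U'.toBlocks₂₁ = c at *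
  generalize U'.toBlocks₂₂ = d at *
  generalize U''.toBlocks₁₁ = e at *
  generalize U''.toBlocks₁₂ = f at *
  generalize U''.toBlocks₂₁ = g at *
  generalize U''.toBlocks₂₂ = h at *
  obtain ⟨Y, hY⟩ : ∃ Y, Y = (1 - V⁻¹ * e * V * d)⁻¹ * (V⁻¹ * (e * (V * (c * A)) + f * B)) :=
    ⟨_, rfl⟩
  have hYfix : Y - V⁻¹ * (e * (V * (d * Y))) = V⁻¹ * (e * (V * (c * A)) + f * B) := by
    have := Matrix.mul_nonsing_inv_cancel_left _ (V⁻¹ * (e * (V * (c * A)) + f * B)) hQ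
    rw [← hY] at this
    simpa only [Matrix.sub_mul, Matrix.one_mul, Matrix.mul_assoc] using this
  have hVY : V * Y = e * (V * (c * A + d * Y)) + f * B := by
    have := congrArg (V * ·) hYfix
    simp only [Matrix.mul_sub, Matrix.mul_nonsing_inv_cancel_left _ _ hV] at this
    rw [sub_eq_iff_eq_add] at this
    rw [this]
    simp only [Matrix.mul_add]
    abel
  have hX : V * (c * A + d * Y) =
      (1 - V * d * V⁻¹ * e)⁻¹ * (V * (c * A + d * (V⁻¹ * (f * B)))) := by
    rw [← Matrix.nonsing_inv_mul_cancel_left _ (V * (c * A + d * Y)) hP]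
    congr 1
    have hY' : Y = V⁻¹ * (e * (V * (c * A + d * Y))) + V⁻¹ * (f * B) := by
      rw [← Matrix.mul_add, ← hVY, Matrix.nonsing_inv_mul_cancel_left _ _ hV]
    have hdY := congrArg (fun Z => V * (d * Z)) hY'
    simp only [Matrix.sub_mul, Matrix.one_mul, Matrix.mul_assoc, Matrix.mul_add] at hdY ⊢
    linear_combination (norm := abel) hdY
  refine ⟨a * A + b * Y, g * (V * (c * A + d * Y)) + h * B, c * A + d * Y, Y, ?_, ?_, ?_⟩
  · rw [hX, hY, fromBlocks_mul_fromRows]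
    simp only [Matrix.add_mul, Matrix.mul_add, Matrix.mul_assoc]
    congr 1 <;> abel
  · rw [fromBlocks_mul_fromRows]
  · rw [fromBlocks_mul_fromRows, hVY]

theorem conjTranspose_mul_self_of_unitary_mul {m n : Type*} [Fintype m] [DecidableEq m]
    {U : Matrix m m ℂ} (hU : U ∈ Matrix.unitaryGroup m ℂ) (A : Matrix m n ℂ) :
    (U * A)ᴴ * (U * A) = Aᴴ * A := by
  rw [conjTranspose_mul, Matrix.mul_assoc, ← Matrix.mul_assoc Uᴴ, ← star_eq_conjTranspose U,
    Matrix.mem_unitaryGroup_iff'.mp hU, Matrix.one_mul]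

/-- The generalized star product of unitary matrices satisfying Condition A is
unitary. -/
theorem starProd_unitary {α β γ : Type*} [Fintype α] [Fintype β] [Fintype γ]
    [DecidableEq α] [DecidableEq β] [DecidableEq γ]
    (hp : 0 < Fintype.card γ) (hsize : 0 < Fintype.card α + Fintype.card β)
    (U' : Matrix (α ⊕ γ) (α ⊕ γ) ℂ) (U'' : Matrix (γ ⊕ β) (γ ⊕ β) ℂ)
    (V : Matrix γ γ ℂ)
    (hU' : U' ∈ Matrix.unitaryGroup (α ⊕ γ) ℂ)
    (hU'' : U'' ∈ Matrix.unitaryGroup (γ ⊕ β) ℂ)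
    (hV : V ∈ Matrix.unitaryGroup γ ℂ)
    (hA : CondA U' U'' V) :
    starProd U' U'' V ∈ Matrix.unitaryGroup (α ⊕ β) ℂ := by
  have hVdet : IsUnit V.det := (Matrix.isUnit_iff_isUnit_det V).mp
    (IsUnit.of_mul_eq_one _ (Matrix.mem_unitaryGroup_iff.mp hV))
  obtain ⟨A', B', X, Y, hS, h', h''⟩ := exists_starProd_mul_fromRows hVdet hA
    (toRows₁ (1 : Matrix (α ⊕ β) (α ⊕ β) ℂ)) (toRows₂ (1 : Matrix (α ⊕ β) (α ⊕ β) ℂ))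
  have e' := conjTranspose_mul_self_of_unitary_mul hU' 
    (fromRows (toRows₁ (1 : Matrix (α ⊕ β) (α ⊕ β) ℂ)) Y)
  have e'' := conjTranspose_mul_self_of_unitary_mul hU'' 
    (fromRows (V * X) (toRows₂ (1 : Matrix (α ⊕ β) (α ⊕ β) ℂ)))
  have e₁ : (1 : Matrix (α ⊕ β) (α ⊕ β) ℂ)ᴴ * 1 = 1 := by simp
  rw [← fromRows_toRows (1 : Matrix (α ⊕ β) (α ⊕ β) ℂ)] at e₁
  rw [h'] at e'
  rw [h''] at e''
  rw [Matrix.mem_unitaryGroup_iff', star_eq_conjTranspose,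
    ← Matrix.mul_one (starProd U' U'' V), ← fromRows_toRows (1 : Matrix (α ⊕ β) (α ⊕ β) ℂ), hS]
  simp only [conjTranspose_fromRows_eq_fromCols_conjTranspose, fromCols_mul_fromRows,
    conjTranspose_mul_self_of_unitary_mul hV] at e' e'' e₁ ⊢
  rw [fromRows_toRows] at e₁ ⊢
  rw [← e₁]
  linear_combination (norm := abel) e' + e''
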